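/- arXiv:1509.00420 — 2 statements merged into one kernel-verified Lean document; each statement's English description precedes it below -/
import Mathlib

section
/- Let A be a left brace (finite or infinite). The following assertions are equivalent: (1) A^{(n)} = 0 and Aᵐ = 0 for some natural numbers m, n; (2) A^{[s]} = 0 for some natural number s; (3) A^{(n)} = 0 for some n and the adjoint group A° is a nilpotent group. -/
namespace Paper

/-- A left brace: an abelian group `(A,+)` with a multiplication `bmul` that is left
distributive over addition and such that the circle operation
`a ∘ b = a·b + a + b` makes `A` into a group (the adjoint group) with identity `0`. -/
class LeftBrace (A : Type*) extends AddCommGroup A where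
  bmul : A → A → A
  bmul_add : ∀ a b c : A, bmul a (b + c) = bmul a b + bmul a c
  circ_assoc : ∀ a b c : A,
    bmul (bmul a b + a + b) c + (bmul a b + a + b) + c
      = bmul a (bmul b c + b + c) + a + (bmul b c + b + c)
  zero_circ : ∀ a : A, bmul 0 a + 0 + a = a
  circ_zero : ∀ a : A, bmul a 0 + a + 0 = a
  exists_circ_inv : ∀ a : A, ∃ b : A, bmul a b + a + b = 0 ∧ bmul b a + b + a = 0

namespace LeftBrace

variable {A : Type*} [LeftBrace A]

/-- The circle operation `a ∘ b = a·b + a + b` of a left brace. -/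
def circ (a b : A) : A := bmul a b + a + b

/-- The adjoint group `A°` of a left brace: the group `(A, ∘)`. -/
noncomputable def adjointGroup (A : Type*) [LeftBrace A] : Group A where
  mul := circ
  one := (0 : A)
  inv a := Classical.choose (exists_circ_inv a)
  mul_assoc := circ_assoc
  one_mul := zero_circ
  mul_one := circ_zero
  inv_mul_cancel a := (Classical.choose_spec (exists_circ_inv a)).2

/-- The adjoint group `A°` of the left brace `A` is a nilpotent group. -/
def AdjointNilpotent (A : Type*) [LeftBrace A] : Prop :=
  @Group.IsNilpotent A (adjointGroup A)

/-- For subsets `C, D ⊆ A`, `C · D` is the set of all finite sums `Σ cᵢ·dᵢ`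
with `cᵢ ∈ C`, `dᵢ ∈ D`, i.e. the additive submonoid generated by the products. -/
def setMulSub (C D : Set A) : AddSubmonoid A :=
  AddSubmonoid.closure {x : A | ∃ c ∈ C, ∃ d ∈ D, x = bmul c d}

/-- `C · D` as a set. -/
def setMul (C D : Set A) : Set A := (setMulSub C D : Set A)

/-- `pow A n = Aⁿ` for `n ≥ 1`: `A¹ = A`, `A^{n+1} = A · Aⁿ`.  (`pow A 0` is set to `A`.) -/
def pow (A : Type*) [LeftBrace A] : ℕ → Set A
  | 0 => Set.univ
  | 1 => Set.univ
  | (n+2) => setMul Set.univ (pow A (n+1))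

/-- `rpow A n = A^{(n)}` for `n ≥ 1`: `A^{(1)} = A`, `A^{(n+1)} = A^{(n)} · A`.
(`rpow A 0` is set to `A`.) -/
def rpow (A : Type*) [LeftBrace A] : ℕ → Set A
  | 0 => Set.univ
  | 1 => Set.univ
  | (n+2) => setMul (rpow A (n+1)) Set.univ

/-- `brk A n = A^{[n]}` for `n ≥ 1`: `A^{[1]} = A`,
`A^{[n+1]} = Σ_{i=1}^{n} A^{[i]} · A^{[n+1-i]}`.  (`brk A 0` is set to `A`.) -/
def brk (A : Type*) [LeftBrace A] : ℕ → Set A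
  | 0 => Set.univ
  | 1 => Set.univ
  | (n+2) =>
    (((Finset.range (n+1)).attach.sup
      (fun i => setMulSub (brk A (i.1 + 1)) (brk A (n + 1 - i.1)))) : AddSubmonoid A)
  decreasing_by
  · have h := i.2; simp only [Finset.mem_range] at h; omega
  · omega


/-- The product of a family of left braces, with componentwise operations. -/
noncomputable def piBrace {ι : Type*} (B : ι → Type*) (instB : ∀ i, LeftBrace (B i)) :
    LeftBrace (∀ i, B i) :=
  letI : ∀ i, LeftBrace (B i) := instB
  { (inferInstance : AddCommGroup (∀ i, B i)) with
    bmul := fun f g i => bmul (f i) (g i)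
    bmul_add := fun a b c => funext fun i => bmul_add (a i) (b i) (c i)
    circ_assoc := fun a b c => funext fun i => circ_assoc (a i) (b i) (c i)
    zero_circ := fun a => funext fun i => zero_circ (a i)
    circ_zero := fun a => funext fun i => circ_zero (a i)
    exists_circ_inv := fun a =>
      ⟨fun i => Classical.choose (exists_circ_inv (a i)),
        funext fun i => (Classical.choose_spec (exists_circ_inv (a i))).1,
        funext fun i => (Classical.choose_spec (exists_circ_inv (a i))).2⟩ }

/-- An isomorphism of left braces: an additive isomorphism preserving the brace
multiplication. -/
structure BraceIso (A B : Type*) [LeftBrace A] [LeftBrace B] extends A ≃+ B where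
  map_bmul : ∀ a b : A, toAddEquiv (bmul a b) = bmul (toAddEquiv a) (toAddEquiv b)

/-- `A` is the direct sum of (finitely many) left braces whose cardinalities are
powers of prime numbers. -/
def IsPrimePowerDirectSum (A : Type*) [LeftBrace A] : Prop :=
  ∃ (k : ℕ) (B : Fin k → Type) (instB : ∀ i, LeftBrace (B i)),
    (∀ i, ∃ p m : ℕ, p.Prime ∧ Nat.card (B i) = p ^ m) ∧
    Nonempty (@BraceIso A (∀ i, B i) _ (piBrace B instB))

section AdjointGroup

attribute [local instance] adjointGroup

theorem mul_eq (a b : A) : a * b = bmul a b + a + b := rfl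

theorem one_eq_zero : (1 : A) = 0 := rfl

theorem bmul_zero (a : A) : bmul a 0 = 0 := by
  simpa using bmul_add a 0 0

theorem bmul_neg (a b : A) : bmul a (-b) = -bmul a b := by
  rw [eq_neg_iff_add_eq_zero, ← bmul_add, neg_add_cancel, bmul_zero]

theorem bmul_inv_self (a : A) : bmul a a⁻¹ = -(a + a⁻¹) := by
  have h : a * a⁻¹ = 1 := mul_inv_cancel a
  rw [mul_eq, one_eq_zero, add_assoc] at h
  exact eq_neg_of_add_eq_zero_left h

theorem mul_bmul (a b c : A) : bmul (a * b) c = bmul a (bmul b c) + bmul a c + bmul b c := by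
  have h := circ_assoc a b c
  rw [bmul_add, bmul_add] at h
  rw [mul_eq, ← sub_eq_zero]
  rw [← sub_eq_zero] at h
  rw [← h]
  abel

theorem conj_eq (a x : A) :
    a * x * a⁻¹ = x + bmul x a⁻¹ + bmul a (x + bmul x a⁻¹) := by
  rw [mul_assoc, mul_eq a, mul_eq x, bmul_add, bmul_add, bmul_add, bmul_inv_self a]
  abel

theorem conj_bmul (a x y : A) :
    bmul (a * x * a⁻¹) (y + bmul a y) = bmul x y + bmul a (bmul x y) := by
  have h := mul_bmul (a * x * a⁻¹) a y
  rw [inv_mul_cancel_right, mul_bmul] at h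
  rw [bmul_add]
  rw [← sub_eq_zero] at h ⊢
  rw [← neg_eq_zero, ← h]
  abel

/-- An additive subgroup is an ideal of a left brace when it absorbs products on both sides. -/
structure IsIdeal (I : AddSubgroup A) : Prop where
  bmul_mem_left : ∀ a, ∀ x ∈ I, bmul a x ∈ I
  bmul_mem_right : ∀ x ∈ I, ∀ a, bmul x a ∈ I

namespace IsIdeal

variable {I : AddSubgroup A}

theorem conj_mem (hI : IsIdeal I) (a : A) {x : A} (hx : x ∈ I) : a * x * a⁻¹ ∈ I := by
  have h := I.add_mem hx (hI.bmul_mem_right x hx a⁻¹)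
  rw [conj_eq]
  exact I.add_mem h (hI.bmul_mem_left a _ h)

theorem mul_mem (hI : IsIdeal I) {x y : A} (hx : x ∈ I) (hy : y ∈ I) : x * y ∈ I :=
  I.add_mem (I.add_mem (hI.bmul_mem_right x hx y) hx) hy

theorem inv_mem (hI : IsIdeal I) {x : A} (hx : x ∈ I) : x⁻¹ ∈ I := by
  have h : x⁻¹ = -(x + bmul x⁻¹ x) := by
    have := bmul_inv_self x⁻¹
    rw [inv_inv] at this
    rw [this]
    abel
  rw [h]
  exact I.neg_mem (I.add_mem hx (hI.bmul_mem_left _ x hx))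

/-- The subgroup of the adjoint group carried by an ideal. -/
def toSubgroup (hI : IsIdeal I) : Subgroup A where
  carrier := I
  mul_mem' := hI.mul_mem
  one_mem' := I.zero_mem
  inv_mem' := hI.inv_mem

theorem commutator_mem (hI : IsIdeal I) (a : A) {x : A} (hx : x ∈ I) :
    a * x * a⁻¹ * x⁻¹ ∈ I :=
  hI.mul_mem (hI.conj_mem a hx) (hI.inv_mem hx)

/-- If `J` contains `A · I` and `I · A`, then it contains the commutators of `A°` with `I`. -/
theorem commutator_mem_of_bmul_mem {J : AddSubgroup A} (hJ : IsIdeal J) {x : A}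
    (hl : ∀ a, bmul a x ∈ J) (hr : ∀ a, bmul x a ∈ J) (a : A) : a * x * a⁻¹ * x⁻¹ ∈ J := by
  set d : A := bmul x a⁻¹ + bmul a (x + bmul x a⁻¹) with hd
  have hdJ : d ∈ J := by
    rw [hd, bmul_add]
    exact J.add_mem (hr _) (J.add_mem (hl a) (hJ.bmul_mem_left a _ (hr _)))
  set e : A := d + bmul x⁻¹ d with he
  have heJ : e ∈ J := J.add_mem hdJ (hJ.bmul_mem_left _ d hdJ)
  have hxe : a * x * a⁻¹ = x * e := by
    have h := mul_bmul x x⁻¹ d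
    have h0 : bmul (1 : A) d = 0 := by
      rw [one_eq_zero]
      simpa using zero_circ d
    rw [mul_inv_cancel, h0] at h
    rw [conj_eq, add_assoc, ← hd, mul_eq, he, bmul_add, ← sub_eq_zero, ← neg_eq_zero, h]
    abel
  rw [hxe]
  exact hJ.conj_mem x heJ

end IsIdeal

theorem bmul_mem_setMulSub {C D : Set A} {c d : A} (hc : c ∈ C) (hd : d ∈ D) :
    bmul c d ∈ setMulSub C D :=
  AddSubmonoid.subset_closure ⟨c, hc, d, hd, rfl⟩

theorem setMulSub_le {C D : Set A} {S : AddSubmonoid A}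
    (h : ∀ c ∈ C, ∀ d ∈ D, bmul c d ∈ S) : setMulSub C D ≤ S := by
  rw [setMulSub, AddSubmonoid.closure_le]
  rintro _ ⟨c, hc, d, hd, rfl⟩
  exact h c hc d hd

theorem neg_mem_setMulSub {C D : Set A} (hD : ∀ d ∈ D, -d ∈ D) {x : A}
    (hx : x ∈ setMulSub C D) : -x ∈ setMulSub C D := by
  have h : setMulSub C D ≤ (setMulSub C D).comap (negAddMonoidHom : A →+ A) :=
    setMulSub_le fun c hc d hd => by
      rw [AddSubmonoid.mem_comap, coe_negAddMonoidHom, ← bmul_neg]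
      exact bmul_mem_setMulSub hc (hD d hd)
  exact h hx

section RightSeries

/-- `A^{(n+1)}` as an additive subgroup. -/
def rpowSubgroup (A : Type*) [LeftBrace A] : ℕ → AddSubgroup A
  | 0 => ⊤
  | n + 1 =>
    { setMulSub (rpowSubgroup A n : Set A) Set.univ with
      neg_mem' := neg_mem_setMulSub fun _ _ => Set.mem_univ _ }

theorem coe_rpowSubgroup (n : ℕ) : (rpowSubgroup A n : Set A) = rpow A (n + 1) := by
  induction n with
  | zero => rfl
  | succ n ih =>
    rw [rpow, ← ih]
    rfl

theorem bmul_mem_rpowSubgroup_succ {n : ℕ} {x : A} (hx : x ∈ rpowSubgroup A n) (a : A) :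
    bmul x a ∈ rpowSubgroup A (n + 1) :=
  bmul_mem_setMulSub (C := (rpowSubgroup A n : Set A)) hx (Set.mem_univ a)

theorem rpowSubgroup_succ_le {n : ℕ} {S : AddSubmonoid A}
    (h : ∀ x ∈ rpowSubgroup A n, ∀ a, bmul x a ∈ S) :
    (rpowSubgroup A (n + 1)).toAddSubmonoid ≤ S :=
  setMulSub_le (C := (rpowSubgroup A n : Set A)) fun c hc d _ => h c hc d

theorem isIdeal_rpowSubgroup (n : ℕ) : IsIdeal (rpowSubgroup A n) := by
  induction n with
  | zero => exact ⟨fun _ _ _ => AddSubgroup.mem_top _, fun _ _ _ => AddSubgroup.mem_top _⟩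
  | succ n ih =>
    refine ⟨fun a x hx => ?_, fun x hx a => bmul_mem_rpowSubgroup_succ ?_ a⟩
    · let f : A →+ A := ⟨⟨bmul a, bmul_zero a⟩, bmul_add a⟩
      have h := rpowSubgroup_succ_le (n := n)
        (S := (rpowSubgroup A (n + 1)).toAddSubmonoid.comap f) fun x hx y => by
          have h1 : bmul a (bmul x y)
              = bmul (a * x * a⁻¹) (y + bmul a y) + -bmul x y := by
            rw [conj_bmul]
            abel
          change bmul a (bmul x y) ∈ rpowSubgroup A (n + 1)
          rw [h1]
          exact add_mem (bmul_mem_rpowSubgroup_succ (ih.conj_mem a hx) _)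
            (neg_mem (bmul_mem_rpowSubgroup_succ hx y))
      exact h hx
    · exact rpowSubgroup_succ_le (S := (rpowSubgroup A n).toAddSubmonoid)
        ih.bmul_mem_right hx

end RightSeries

theorem zero_mem_pow (n : ℕ) : (0 : A) ∈ pow A n := by
  match n with
  | 0 => trivial
  | 1 => trivial
  | n + 2 => exact (setMulSub Set.univ (pow A (n + 1))).zero_mem

theorem pow_succ_subset {n : ℕ} {S : AddSubmonoid A} (hn : 1 ≤ n)
    (h : ∀ a, ∀ x ∈ pow A n, bmul a x ∈ S) : pow A (n + 1) ⊆ S := by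
  obtain ⟨n, rfl⟩ := Nat.exists_eq_add_of_le' hn
  exact setMulSub_le fun c _ d hd => h c d hd

section Bracket

theorem bmul_mem_brk {i j : ℕ} (hi : 1 ≤ i) (hj : 1 ≤ j) {c d : A} (hc : c ∈ brk A i)
    (hd : d ∈ brk A j) : bmul c d ∈ brk A (i + j) := by
  obtain ⟨i, rfl⟩ := Nat.exists_eq_add_of_le' hi
  obtain ⟨j, rfl⟩ := Nat.exists_eq_add_of_le' hj
  rw [show i + 1 + (j + 1) = i + j + 2 by omega, brk]
  have hmem : i ∈ Finset.range (i + j + 1) := by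
    rw [Finset.mem_range]
    omega
  have hle := Finset.le_sup (f := fun k : {k // k ∈ Finset.range (i + j + 1)} =>
    setMulSub (brk A (k.1 + 1)) (brk A (i + j + 1 - k.1))) (Finset.mem_attach _ ⟨i, hmem⟩)
  refine hle (bmul_mem_setMulSub hc ?_)
  rwa [show i + j + 1 - i = j + 1 by omega]

theorem brk_subset {n : ℕ} {S : AddSubmonoid A} (hn : 2 ≤ n)
    (h : ∀ i j, 1 ≤ i → 1 ≤ j → i + j = n → ∀ c ∈ brk A i, ∀ d ∈ brk A j, bmul c d ∈ S) :
    brk A n ⊆ S := by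
  obtain ⟨n, rfl⟩ := Nat.exists_eq_add_of_le' hn
  rw [brk, SetLike.coe_subset_coe]
  refine Finset.sup_le fun k _ => setMulSub_le ?_
  have hk := Finset.mem_range.1 k.2
  exact h _ _ (by omega) (by omega) (by omega)

/-- `A^{[n]}` as an additive submonoid. -/
def brkSubmonoid (A : Type*) [LeftBrace A] (n : ℕ) : AddSubmonoid A where
  carrier := brk A n
  zero_mem' := by
    match n with
    | 0 => simp [brk]
    | 1 => simp [brk]
    | n + 2 =>
      rw [brk]
      exact AddSubmonoid.zero_mem _
  add_mem' := by
    match n with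
    | 0 => simp [brk]
    | 1 => simp [brk]
    | n + 2 =>
      rw [brk]
      exact fun {_ _} ha hb => AddSubmonoid.add_mem _ ha hb

theorem neg_mem_brk (n : ℕ) : ∀ {x : A}, x ∈ brk A n → -x ∈ brk A n := by
  induction n using Nat.strong_induction_on with
  | _ n ih =>
    intro x hx
    rcases Nat.lt_or_ge n 2 with hn | hn
    · interval_cases n <;> simp [brk]
    · have h : brk A n ⊆ (brkSubmonoid A n).comap (negAddMonoidHom : A →+ A) :=
        brk_subset hn fun i j hi hj hij c hc d hd => by
          change -bmul c d ∈ brk A n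
          rw [← bmul_neg, ← hij]
          exact bmul_mem_brk hi hj hc (ih j (by omega) hd)
      exact h hx

/-- `A^{[n]}` as an additive subgroup. -/
def brkSubgroup (A : Type*) [LeftBrace A] (n : ℕ) : AddSubgroup A :=
  { brkSubmonoid A n with neg_mem' := neg_mem_brk n }

theorem brk_one : brk A 1 = Set.univ := by rw [brk]

theorem mem_brk_one (a : A) : a ∈ brk A 1 := by
  rw [brk_one]
  trivial

theorem brk_succ_subset (n : ℕ) : brk A (n + 1) ⊆ brk A n := by
  induction n using Nat.strong_induction_on with
  | _ n ih =>
    rcases Nat.lt_or_ge n 2 with hn | hn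
    · interval_cases n <;> simp [brk]
    · refine brk_subset (S := brkSubmonoid A n) (by omega) fun i j hi hj hij c hc d hd => ?_
      change bmul c d ∈ brk A n
      rcases Nat.lt_or_ge i 2 with hi2 | hi2
      · obtain ⟨j, rfl⟩ := Nat.exists_eq_add_of_le' hj
        rw [show n = i + j by omega]
        exact bmul_mem_brk hi (by omega) hc (ih j (by omega) hd)
      · obtain ⟨i, rfl⟩ := Nat.exists_eq_add_of_le' hi
        rw [show n = i + j by omega]
        exact bmul_mem_brk (by omega) hj (ih i (by omega) hc) hd

theorem brk_antitone : Antitone (brk A) := antitone_nat_of_succ_le brk_succ_subset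

theorem isIdeal_brkSubgroup {n : ℕ} (hn : 1 ≤ n) : IsIdeal (brkSubgroup A n) where
  bmul_mem_left a x hx := by
    have h := bmul_mem_brk le_rfl hn (mem_brk_one a) hx
    rw [add_comm] at h
    exact brk_succ_subset n h
  bmul_mem_right x hx a := brk_succ_subset n (bmul_mem_brk hn le_rfl hx (mem_brk_one a))

theorem pow_subset_brk {n : ℕ} (hn : 1 ≤ n) : pow A n ⊆ brk A n := by
  induction n, hn using Nat.le_induction with
  | base => simp [brk]
  | succ n hn ih =>
    refine pow_succ_subset (S := brkSubmonoid A (n + 1)) hn fun a x hx => ?_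
    have h := bmul_mem_brk le_rfl hn (mem_brk_one a) (ih hx)
    rwa [add_comm] at h

theorem rpowSubgroup_subset_brk (n : ℕ) : (rpowSubgroup A n : Set A) ⊆ brk A (n + 1) := by
  induction n with
  | zero => simp [brk]
  | succ n ih =>
    exact rpowSubgroup_succ_le (S := brkSubmonoid A (n + 2)) fun x hx a =>
      bmul_mem_brk (by omega) le_rfl (ih hx) (mem_brk_one a)

end Bracket

theorem brk_subset_rpow_sup_pow {k s : ℕ} (hs : 1 ≤ s)
    (h : brk A s ⊆ rpowSubgroup A k) (j : ℕ) :
    brk A (1 + j * s) ⊆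
      ((rpowSubgroup A (k + 1)).toAddSubmonoid ⊔ AddSubmonoid.closure (pow A (j + 1)) :
        AddSubmonoid A) := by
  induction j with
  | zero =>
    intro x _
    exact AddSubmonoid.mem_sup_right (AddSubmonoid.subset_closure trivial)
  | succ j ih =>
    have hmul : (j + 1) * s = j * s + s := Nat.succ_mul j s
    refine brk_subset (by omega) fun p q hp hq hpq c hc d hd => ?_
    rcases Nat.lt_or_ge p s with hps | hps
    · have hd' := ih (brk_antitone (show 1 + j * s ≤ q by omega) hd)
      obtain ⟨u, hu, v, hv, rfl⟩ := AddSubmonoid.mem_sup.1 hd'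
      rw [bmul_add]
      refine add_mem (AddSubmonoid.mem_sup_left
        ((isIdeal_rpowSubgroup (k + 1)).bmul_mem_left c u hu)) (AddSubmonoid.mem_sup_right ?_)
      let f : A →+ A := ⟨⟨bmul c, bmul_zero c⟩, bmul_add c⟩
      have hle : AddSubmonoid.closure (pow A (j + 1))
          ≤ (AddSubmonoid.closure (pow A (j + 2))).comap f :=
        AddSubmonoid.closure_le.2 fun x hx => AddSubmonoid.subset_closure
          (bmul_mem_setMulSub (Set.mem_univ c) hx)
      exact hle hv
    · exact AddSubmonoid.mem_sup_left
        (bmul_mem_rpowSubgroup_succ (h (brk_antitone hps hc)) d)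

theorem exists_brk_subset_rpow {m : ℕ} (hm : 1 ≤ m) (h : pow A m = {0}) (k : ℕ) :
    ∃ s, 1 ≤ s ∧ brk A s ⊆ rpowSubgroup A k := by
  induction k with
  | zero => exact ⟨1, le_rfl, fun _ _ => AddSubgroup.mem_top _⟩
  | succ k ih =>
    obtain ⟨s, hs, hsk⟩ := ih
    obtain ⟨m, rfl⟩ := Nat.exists_eq_add_of_le' hm
    refine ⟨1 + m * s, by omega, ?_⟩
    have hsub := brk_subset_rpow_sup_pow hs hsk m
    rw [h, AddSubmonoid.closure_singleton_zero, sup_bot_eq] at hsub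
    exact hsub

theorem adjointNilpotent_of_brk {s : ℕ} (hs : 1 ≤ s) (h : brk A s = {0}) :
    AdjointNilpotent A := by
  obtain ⟨s, rfl⟩ := Nat.exists_eq_add_of_le' hs
  refine (Subgroup.nilpotent_iff_finite_descending_central_series A).2
    ⟨s, fun n => (isIdeal_brkSubgroup (A := A) (Nat.le_add_left 1 n)).toSubgroup,
      ⟨?_, fun x n hx g => ?_⟩, ?_⟩
  · refine eq_top_iff.2 fun x _ => mem_brk_one x
  · have hl : ∀ a, bmul a x ∈ brkSubgroup A (n + 1 + 1) := fun a => by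
      have := bmul_mem_brk le_rfl (by omega) (mem_brk_one a) hx
      rwa [add_comm] at this
    have hr : ∀ a, bmul x a ∈ brkSubgroup A (n + 1 + 1) := fun a =>
      bmul_mem_brk (by omega) le_rfl hx (mem_brk_one a)
    have hI : IsIdeal (brkSubgroup A (n + 1 + 1)) := isIdeal_brkSubgroup (by omega)
    have h : x * g * x⁻¹ * g⁻¹ ∈ brkSubgroup A (n + 1 + 1) := by
      simpa [mul_assoc] using hI.inv_mem (hI.commutator_mem_of_bmul_mem hl hr g)
    exact h
  · refine (Subgroup.eq_bot_iff_forall _).2 fun x hx => ?_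
    have hx' : x ∈ brk A (s + 1) := hx
    rw [h] at hx'
    exact hx'

/-- `(A^{(k+1)} ∩ γ_j(A°)) + A^{(k+2)}`. -/
def lowerCentralAdd (A : Type*) [LeftBrace A] (k j : ℕ) : AddSubmonoid A where
  carrier := {x | ∃ g ∈ rpowSubgroup A k, g ∈ (⊤ : Subgroup A).lowerCentralSeries j ∧
    ∃ d ∈ rpowSubgroup A (k + 1), x = g + d}
  zero_mem' := ⟨0, zero_mem _, one_mem ((⊤ : Subgroup A).lowerCentralSeries j), 0, zero_mem _, by simp⟩
  add_mem' := by
    rintro _ _ ⟨g, hg, hgj, d, hd, rfl⟩ ⟨g', hg', hgj', d', hd', rfl⟩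
    refine ⟨g * g', (isIdeal_rpowSubgroup k).mul_mem hg hg', mul_mem hgj hgj',
      d + d' - bmul g g', sub_mem (add_mem hd hd') (bmul_mem_rpowSubgroup_succ hg g'), ?_⟩
    rw [mul_eq]
    abel

theorem bmul_mem_lowerCentralAdd {k j : ℕ} (a : A) {x : A} (hx : x ∈ lowerCentralAdd A k j) :
    bmul a x ∈ lowerCentralAdd A k (j + 1) := by
  obtain ⟨g, hg, hgj, d, hd, rfl⟩ := hx
  have hI := isIdeal_rpowSubgroup (A := A) k
  have hJ := isIdeal_rpowSubgroup (A := A) (k + 1)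
  set c : A := a * g * a⁻¹ * g⁻¹ with hc
  have hcI : c ∈ rpowSubgroup A k := hI.commutator_mem a hg
  have hcg : c * g = a * g * a⁻¹ := by rw [hc, inv_mul_cancel_right]
  have hcj : c ∈ (⊤ : Subgroup A).lowerCentralSeries (j + 1) := by
    have h := inv_mem (Subgroup.commutator_mem_commutator hgj (Subgroup.mem_top a))
    rw [commutatorElement_inv, commutatorElement_def] at h
    exact h
  have hga := bmul_mem_rpowSubgroup_succ hg a⁻¹
  refine ⟨c, hcI, hcj, bmul c g - (bmul g a⁻¹ + bmul a (bmul g a⁻¹)) + bmul a d,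
    add_mem (sub_mem (bmul_mem_rpowSubgroup_succ hcI g)
      (add_mem hga (hJ.bmul_mem_left a _ hga))) (hJ.bmul_mem_left a d hd), ?_⟩
  rw [conj_eq, mul_eq, bmul_add] at hcg
  rw [bmul_add, ← sub_eq_zero, ← neg_eq_zero]
  rw [← sub_eq_zero] at hcg
  rw [← hcg]
  abel

theorem exists_pow_subset_rpow (h : AdjointNilpotent A) (k : ℕ) :
    ∃ m, 1 ≤ m ∧ pow A m ⊆ rpowSubgroup A k := by
  induction k with
  | zero => exact ⟨1, le_rfl, fun _ _ => AddSubgroup.mem_top _⟩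
  | succ k ih =>
    obtain ⟨m, hm, hmk⟩ := ih
    have key : ∀ j, pow A (m + j) ⊆ lowerCentralAdd A k j := fun j => by
      induction j with
      | zero => exact fun x hx => ⟨x, hmk hx, Subgroup.mem_top x, 0, zero_mem _, by simp⟩
      | succ j ihj =>
        exact pow_succ_subset (n := m + j) (by omega) fun a x hx => bmul_mem_lowerCentralAdd a (ihj hx)
    obtain ⟨c, hc⟩ := Subgroup.nilpotent_iff_lowerCentralSeries.1 h
    refine ⟨m + c, by omega, fun x hx => ?_⟩
    obtain ⟨g, -, hg, d, hd, rfl⟩ := key c hx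
    rw [hc, Subgroup.mem_bot, one_eq_zero] at hg
    rwa [hg, zero_add]

end AdjointGroup

/-- For a left brace `A` the following are equivalent:
(1) `A^{(n)} = 0` and `Aᵐ = 0` for some `m, n`;
(2) `A^{[s]} = 0` for some `s`;
(3) `A^{(n)} = 0` for some `n` and the adjoint group `A°` is nilpotent. -/
theorem leftBrace_tfae (A : Type) [LeftBrace A] :
    List.TFAE [
      ∃ m n : ℕ, 1 ≤ m ∧ 1 ≤ n ∧ pow A m = {0} ∧ rpow A n = {0},
      ∃ s : ℕ, 1 ≤ s ∧ brk A s = {0},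
      (∃ n : ℕ, 1 ≤ n ∧ rpow A n = {0}) ∧ AdjointNilpotent A ] := by
  have hR : ∀ n, 1 ≤ n → rpow A n = {0} → ∃ k, (rpowSubgroup A k : Set A) = {0} := by
    intro n hn h
    obtain ⟨n, rfl⟩ := Nat.exists_eq_add_of_le' hn
    exact ⟨n, (coe_rpowSubgroup n).trans h⟩
  tfae_have 1 → 2 := by
    rintro ⟨m, n, hm, hn, hpow, hrpow⟩
    obtain ⟨k, hk⟩ := hR n hn hrpow
    obtain ⟨s, hs, hsub⟩ := exists_brk_subset_rpow hm hpow k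
    exact ⟨s, hs, (hsub.trans hk.subset).antisymm
      (Set.singleton_subset_iff.2 (brkSubmonoid A s).zero_mem)⟩
  tfae_have 2 → 1 := by
    rintro ⟨s, hs, h⟩
    refine ⟨s, s, hs, hs, ?_, ?_⟩
    · exact ((pow_subset_brk hs).trans h.subset).antisymm
        (Set.singleton_subset_iff.2 (zero_mem_pow s))
    · obtain ⟨s, rfl⟩ := Nat.exists_eq_add_of_le' hs
      rw [← coe_rpowSubgroup]
      exact ((rpowSubgroup_subset_brk s).trans h.subset).antisymm
        (Set.singleton_subset_iff.2 (zero_mem _))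
  tfae_have 2 → 3 := by
    rintro ⟨s, hs, h⟩
    obtain ⟨_, n, _, hn, _, hrpow⟩ := tfae_2_to_1 ⟨s, hs, h⟩
    exact ⟨⟨n, hn, hrpow⟩, adjointNilpotent_of_brk hs h⟩
  tfae_have 3 → 1 := by
    rintro ⟨⟨n, hn, hrpow⟩, hnil⟩
    obtain ⟨k, hk⟩ := hR n hn hrpow
    obtain ⟨m, hm, hsub⟩ := exists_pow_subset_rpow hnil k
    exact ⟨m, n, hm, hn, (hsub.trans hk.subset).antisymm
      (Set.singleton_subset_iff.2 (zero_mem_pow m)), hrpow⟩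
  tfae_finish

end LeftBrace

end Paper
end

section
/- Let A be a finite left brace of cardinality p₁^{α₁}⋯p_k^{α_k} for pairwise distinct primes p₁,…,p_k and positive integers α₁,…,α_k. Then A = A₁ + A₂ + ⋯ + A_k, where for each i ≤ k, A_i is the (unique) additive subgroup of (A,+) of cardinality p_i^{α_i} (the Sylow p_i-subgroup of (A,+)); moreover each A_i is closed under the multiplication of A and, with the inherited addition and multiplication, (A_i, +, ·) is a left brace. -/
namespace Paper

namespace LeftBrace

variable {A : Type*} [LeftBrace A]

/-- The elements of `A` annihilated by `n`. -/
def nsmulKer (A : Type*) [AddCommGroup A] (n : ℕ) : AddSubgroup A :=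
  (nsmulAddMonoidHom (α := A) n).ker

theorem mem_nsmulKer {A : Type*} [AddCommGroup A] {n : ℕ} {x : A} :
    x ∈ nsmulKer A n ↔ n • x = 0 := Iff.rfl

/-- Left multiplication in a left brace, as an additive homomorphism. -/
def bmulHom (a : A) : A →+ A :=
  AddMonoidHom.mk' (bmul a) (bmul_add a)

theorem bmul_mem_nsmulKer {n : ℕ} (a : A) {x : A} (hx : x ∈ nsmulKer A n) :
    bmul a x ∈ nsmulKer A n := by
  rw [mem_nsmulKer] at hx ⊢
  have h := map_nsmul (bmulHom a) n x
  rw [hx, map_zero] at h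
  exact h.symm

/-- An additive subgroup closed under left multiplication by all elements is a left brace
with the inherited operations. -/
abbrev ofLeftIdeal (B : AddSubgroup A) (hB : ∀ a : A, ∀ x ∈ B, bmul a x ∈ B) :
    LeftBrace B where
  toAddCommGroup := inferInstance
  bmul x y := ⟨bmul (x : A) y, hB x y y.2⟩
  bmul_add a b c := Subtype.ext (bmul_add (a : A) b c)
  circ_assoc a b c := Subtype.ext (circ_assoc (a : A) b c)
  zero_circ a := Subtype.ext (zero_circ (a : A))
  circ_zero a := Subtype.ext (circ_zero (a : A))
  exists_circ_inv a := by
    obtain ⟨b, hab, hba⟩ := exists_circ_inv (a : A)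
    have hb : b ∈ B := by
      have h : b = -(bmul b (a : A)) - a := by
        rw [← sub_eq_zero, ← hba]
        abel
      rw [h]
      exact B.sub_mem (B.neg_mem (hB b a a.2)) a.2
    exact ⟨⟨b, hb⟩, Subtype.ext hab, Subtype.ext hba⟩

/-- A subgroup whose order is coprime to its index is the kernel of multiplication by
its order. -/
theorem eq_nsmulKer_of_coprime {A : Type*} [AddCommGroup A] {q m : ℕ}
    (hA : Nat.card A = q * m) (hqm : q.Coprime m) (hq : 0 < q) (C : AddSubgroup A)
    (hC : Nat.card C = q) : C = nsmulKer A q := by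
  have hm : Nat.card (A ⧸ C) = m := by
    have h := C.card_eq_card_quotient_mul_card_addSubgroup
    rw [hA, hC, mul_comm] at h
    exact (Nat.eq_of_mul_eq_mul_right hq h).symm
  ext x
  rw [mem_nsmulKer]
  constructor
  · intro hx
    have h : q • (⟨x, hx⟩ : C) = 0 := hC ▸ card_nsmul_eq_zero'
    exact congrArg Subtype.val h
  · intro hx
    rw [← QuotientAddGroup.eq_zero_iff]
    have h₁ : addOrderOf (x : A ⧸ C) ∣ q := by
      rw [addOrderOf_dvd_iff_nsmul_eq_zero, ← QuotientAddGroup.mk_nsmul, hx,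
        QuotientAddGroup.mk_zero]
    have h₂ : addOrderOf (x : A ⧸ C) ∣ m := hm ▸ addOrderOf_dvd_natCard _
    exact AddMonoid.addOrderOf_eq_one_iff.mp (Nat.eq_one_of_dvd_coprimes hqm h₁ h₂)

theorem exists_addSubgroup_card_pow_prime {A : Type*} [AddCommGroup A] [Finite A]
    {p n : ℕ} (hp : p.Prime) (h : p ^ n ∣ Nat.card A) :
    ∃ C : AddSubgroup A, Nat.card C = p ^ n := by
  have := Fact.mk hp
  obtain ⟨K, hK⟩ := Sylow.exists_subgroup_card_pow_prime (G := Multiplicative A) p h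
  exact ⟨K.toAddSubgroup', hK⟩

/-- A group annihilated by a product of pairwise coprime numbers is the sum of the kernels of
multiplication by the factors. -/
theorem exists_sum_mem_nsmulKer {A ι : Type*} [AddCommGroup A] [Fintype ι] {q : ι → ℕ}
    (hq : Pairwise (Function.onFun Nat.Coprime q)) (hA : ∀ a : A, (∏ i, q i) • a = 0) (a : A) :
    ∃ f : ι → A, (∀ i, f i ∈ nsmulKer A (q i)) ∧ a = ∑ i, f i := by
  classical
  cases isEmpty_or_nonempty ι with
  | inl h => exact ⟨isEmptyElim, isEmptyElim, by simpa using hA a⟩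
  | inr h =>
    obtain ⟨u, hu⟩ := (exists_sum_eq_one_iff_pairwise_coprime'
      (s := fun i => (q i : ℤ))).mpr fun i j hij => Nat.isCoprime_iff_coprime.mpr (hq hij)
    refine ⟨fun i => (u i * ∏ j ∈ {i}ᶜ, (q j : ℤ)) • a, fun i => ?_, ?_⟩
    · have h : (q i : ℤ) * (u i * ∏ j ∈ {i}ᶜ, (q j : ℤ)) = u i * ((∏ j, q j : ℕ) : ℤ) := by
        rw [Nat.cast_prod, Fintype.prod_eq_mul_prod_compl i]
        ring
      rw [mem_nsmulKer, ← natCast_zsmul, smul_smul, h, mul_smul, natCast_zsmul, hA, smul_zero]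
    · rw [← Finset.sum_smul, hu, one_smul]

/-- Let `A` be a finite left brace of cardinality
`p₁^{α₁}⋯p_k^{α_k}` with `p₁,…,p_k` pairwise distinct primes and `αᵢ > 0`.  Then
`A = A₁ + ⋯ + A_k` where `Aᵢ` is the unique additive subgroup of `(A,+)` of
cardinality `pᵢ^{αᵢ}`; each `Aᵢ` is closed under the brace multiplication and, with
the inherited operations, is a left brace. -/
theorem finite_leftBrace_sylow_decomposition
    (A : Type) [LeftBrace A] [Finite A] (k : ℕ) (p α : Fin k → ℕ)
    (hp : ∀ i, (p i).Prime) (hpne : ∀ i j, i ≠ j → p i ≠ p j)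
    (hα : ∀ i, 0 < α i) (hcard : Nat.card A = ∏ i, p i ^ α i) :
    ∃ B : Fin k → AddSubgroup A,
      (∀ i, Nat.card (B i) = p i ^ α i) ∧
      (∀ i, ∀ C : AddSubgroup A, Nat.card C = p i ^ α i → C = B i) ∧
      (∀ a : A, ∃ f : Fin k → A, (∀ i, f i ∈ B i) ∧ a = ∑ i, f i) ∧
      (∀ i, ∀ x ∈ B i, ∀ y ∈ B i, bmul x y ∈ B i) ∧
      (∀ i, ∃ inst : LeftBrace (B i),
          inst.toAddCommGroup = (inferInstance : AddCommGroup (B i)) ∧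
          (∀ x y : B i, (inst.bmul x y : A) = bmul (x : A) (y : A))) := by
  have hq : Pairwise (Function.onFun Nat.Coprime fun i => p i ^ α i) := fun i j hij =>
    Nat.coprime_pow_primes _ _ (hp i) (hp j) (hpne i j hij)
  have hker : ∀ i, ∀ C : AddSubgroup A, Nat.card C = p i ^ α i →
      C = nsmulKer A (p i ^ α i) := fun i C hC =>
    eq_nsmulKer_of_coprime (hcard.trans (Fintype.prod_eq_mul_prod_compl i _))
      (Nat.Coprime.prod_right fun j hj => hq fun h => by simp [h] at hj)
      (pow_pos (hp i).pos _) C hC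
  refine ⟨fun i => nsmulKer A (p i ^ α i), fun i => ?_, hker, ?_,
    fun i x _ y hy => bmul_mem_nsmulKer x hy,
    fun i => ⟨ofLeftIdeal _ fun a x hx => bmul_mem_nsmulKer a hx, rfl, fun _ _ => rfl⟩⟩
  · obtain ⟨C, hC⟩ := exists_addSubgroup_card_pow_prime (A := A) (n := α i) (hp i)
      (hcard ▸ Finset.dvd_prod_of_mem (fun i => p i ^ α i) (Finset.mem_univ i))
    rwa [hker i C hC] at hC
  · exact exists_sum_mem_nsmulKer hq fun a => hcard ▸ card_nsmul_eq_zero'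

end LeftBrace

end Paper
end
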